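/- arXiv:1001.1901 — 2 statements merged into one kernel-verified Lean document; each statement's English description precedes it below -/
import Mathlib

section
/- Let ξ be a cost-sharing scheme, let L ⊆ S ⊆ U ⊆ A, and let b be a bid vector. If there exists a nonempty set T ⊆ A∖S such that b_i ≥ ξ(i,S∪T) for all i ∈ T and b_i > ξ(i,S∪T) for at least one i ∈ T, then the pair (L,U) is not stable at b. -/
open Finset

variable {n : ℕ}

/-- A cost-sharing scheme: nonnegative payments, and zero payment for non-serviced players. -/
def IsCostSharingScheme (ξ : Fin n → Finset (Fin n) → ℝ) : Prop :=
  (∀ i S, 0 ≤ ξ i S) ∧ (∀ i S, i ∉ S → ξ i S = 0)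

/-- The minimum payment ξ*(i,L,U) = min{ ξ(i,S) : L ⊆ S ⊆ U, i ∈ S }. -/
noncomputable def xiStar (ξ : Fin n → Finset (Fin n) → ℝ) (L U : Finset (Fin n)) (i : Fin n) : ℝ :=
  sInf {x : ℝ | ∃ S : Finset (Fin n), L ⊆ S ∧ S ⊆ U ∧ i ∈ S ∧ ξ i S = x}

/-- Fence Monotonicity at a pair L ⊆ U. -/
def FenceMonoAt (ξ : Fin n → Finset (Fin n) → ℝ) (L U : Finset (Fin n)) : Prop :=
  (∃ S : Finset (Fin n), L ⊆ S ∧ S ⊆ U ∧ ∀ i ∈ S, ξ i S = xiStar ξ L U i) ∧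
  (∀ i ∈ U \ L, ∃ S : Finset (Fin n), L ⊆ S ∧ S ⊆ U ∧ i ∈ S ∧
    ∀ j ∈ S \ L, ξ j S = xiStar ξ L U j) ∧
  (∀ C : Finset (Fin n), C ⊂ U → (∃ i ∈ C, ξ i C < xiStar ξ L U i) →
    ∃ T : Finset (Fin n), T.Nonempty ∧ T ⊆ L \ C ∧ ∀ j ∈ T, ξ j (C ∪ T) = xiStar ξ L U j)

/-- Fence Monotonicity: the three conditions hold at every pair L ⊆ U. -/
def FenceMonotone (ξ : Fin n → Finset (Fin n) → ℝ) : Prop :=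
  ∀ L U : Finset (Fin n), L ⊆ U → FenceMonoAt ξ L U

/-- Voluntary participation: a serviced player is never charged more than her bid. -/
def VP (ξ : Fin n → Finset (Fin n) → ℝ) (O : (Fin n → ℝ) → Finset (Fin n)) : Prop :=
  ∀ b : Fin n → ℝ, ∀ i ∈ O b, ξ i (O b) ≤ b i

/-- Consumer sovereignty: each player has a bid that guarantees service. -/
def CS (O : (Fin n → ℝ) → Finset (Fin n)) : Prop :=
  ∀ i : Fin n, ∃ bstar : ℝ, ∀ b : Fin n → ℝ, b i = bstar → i ∈ O b

/-- Utility of player `i` with true value `v i` at bid vector `b`. -/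
noncomputable def utility (ξ : Fin n → Finset (Fin n) → ℝ) (O : (Fin n → ℝ) → Finset (Fin n))
    (v b : Fin n → ℝ) (i : Fin n) : ℝ :=
  if i ∈ O b then v i - ξ i (O b) else 0

/-- Group-strategyproofness. -/
def GSP (ξ : Fin n → Finset (Fin n) → ℝ) (O : (Fin n → ℝ) → Finset (Fin n)) : Prop :=
  ∀ v v' : Fin n → ℝ,
    (∃ i : Fin n, v i ≠ v' i ∧ utility ξ O v v' i < utility ξ O v v i) ∨
    (∀ i : Fin n, utility ξ O v v' i = utility ξ O v v i)

/-- The pair (L,U) is stable at the bid vector b. -/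
def StablePair (ξ : Fin n → Finset (Fin n) → ℝ) (b : Fin n → ℝ) (L U : Finset (Fin n)) : Prop :=
  L ⊆ U ∧
  (∀ i ∈ L, xiStar ξ L U i < b i) ∧
  (∀ i ∈ U \ L, b i = xiStar ξ L U i) ∧
  (∀ R : Finset (Fin n), R ⊆ Uᶜ → R.Nonempty → ∃ i ∈ R, b i < xiStar ξ L (U ∪ R) i)

/-- Player i harms player j (at the pair L ⊆ U). -/
def Harms (ξ : Fin n → Finset (Fin n) → ℝ) (L U : Finset (Fin n)) (i j : Fin n) : Prop :=
  j ≠ i ∧ xiStar ξ L U j < xiStar ξ (insert i L) U j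

/-- The minimum payment is at most the payment in any admissible set. -/
theorem xiStar_le {ξ : Fin n → Finset (Fin n) → ℝ} (hξ : IsCostSharingScheme ξ)
    {L S U : Finset (Fin n)} {i : Fin n} (hLS : L ⊆ S) (hSU : S ⊆ U) (hi : i ∈ S) :
    xiStar ξ L U i ≤ ξ i S := by
  refine csInf_le ⟨0, ?_⟩ ⟨S, hLS, hSU, hi, rfl⟩
  rintro _ ⟨S', -, -, -, rfl⟩
  exact hξ.1 i S'

/-- If L ⊆ S ⊆ U and some nonempty T disjoint from S has every member able
to pay her charge in S∪T, strictly for at least one member, then (L,U) is not stable at b. -/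
theorem stmt12 (ξ : Fin n → Finset (Fin n) → ℝ) (hξ : IsCostSharingScheme ξ)
    (L S U : Finset (Fin n)) (hLS : L ⊆ S) (hSU : S ⊆ U) (b : Fin n → ℝ)
    (T : Finset (Fin n)) (hT : T.Nonempty) (hTS : T ⊆ Sᶜ)
    (hge : ∀ i ∈ T, ξ i (S ∪ T) ≤ b i) (hstrict : ∃ i ∈ T, ξ i (S ∪ T) < b i) :
    ¬ StablePair ξ b L U := by
  rintro ⟨-, -, heq, hR⟩
  by_cases hTU : T ⊆ U
  · obtain ⟨i, hi, hlt⟩ := hstrict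
    have hiL : i ∉ L := fun h => mem_compl.1 (hTS hi) (hLS h)
    have hle : xiStar ξ L U i ≤ ξ i (S ∪ T) :=
      xiStar_le hξ (hLS.trans subset_union_left) (union_subset hSU hTU) (mem_union_right S hi)
    exact (hle.trans_lt hlt).ne' (heq i (mem_sdiff.2 ⟨hTU hi, hiL⟩))
  · obtain ⟨i, hi, hlt⟩ := hR (T \ U) (fun i hi => mem_compl.2 (mem_sdiff.1 hi).2)
      (sdiff_nonempty.2 hTU)
    have hiT : i ∈ T := (mem_sdiff.1 hi).1
    have hle : xiStar ξ L (U ∪ T \ U) i ≤ ξ i (S ∪ T) := by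
      rw [union_sdiff_self_eq_union]
      exact xiStar_le hξ (hLS.trans subset_union_left) (union_subset_union_left hSU)
        (mem_union_right S hiT)
    exact (hlt.trans_le (hle.trans (hge i hiT))).false
end

section
/- Let ξ be a cost-sharing scheme, let L ⊆ U ⊆ A, and let k ∈ U∖L be a sink of the harm relation on U∖L, i.e., k harms no player in U∖L. If ξ satisfies condition (a) of Fence Monotonicity at the pair (L∪{k},U) — that is, there exists a set S with L∪{k} ⊆ S ⊆ U such that ξ(i,S) = ξ*(i,L∪{k},U) for all i ∈ S — then there exists a set S_k with L ⊆ S_k ⊆ U and k ∈ S_k such that ξ(j,S_k) = ξ*(j,L,U) for all j ∈ S_k∖L; that is, condition (b) of Fence Monotonicity is satisfied for k at the pair (L,U). -/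
open Finset

variable {n : ℕ}

/-- Raising the lower fence can only raise the minimum payment. -/
theorem xiStar_mono_left {ξ : Fin n → Finset (Fin n) → ℝ} (hξ : IsCostSharingScheme ξ)
    {L L' U : Finset (Fin n)} (hL : L ⊆ L') (hU : L' ⊆ U) {i : Fin n} (hi : i ∈ U) :
    xiStar ξ L U i ≤ xiStar ξ L' U i := by
  refine csInf_le_csInf ⟨0, ?_⟩ ⟨ξ i U, U, hU, Subset.rfl, hi, rfl⟩ ?_
  · rintro _ ⟨S, -, -, -, rfl⟩
    exact hξ.1 i S
  · rintro _ ⟨S, hS, hSU, hiS, rfl⟩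
    exact ⟨S, hL.trans hS, hSU, hiS, rfl⟩

/-- Forcing a player into the lower fence does not change her own minimum payment. -/
theorem xiStar_insert_self (ξ : Fin n → Finset (Fin n) → ℝ) (L U : Finset (Fin n)) (k : Fin n) :
    xiStar ξ (insert k L) U k = xiStar ξ L U k := by
  unfold xiStar
  congr 1
  ext x
  simp only [insert_subset_iff, Set.mem_ofPred_eq]
  grind

/-- If k ∈ U∖L is a sink of the harm relation on U∖L and condition (a) of
Fence Monotonicity holds at (L∪{k},U), then condition (b) of Fence Monotonicity holds for
k at (L,U). -/
theorem stmt19 (ξ : Fin n → Finset (Fin n) → ℝ) (hξ : IsCostSharingScheme ξ)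
    (L U : Finset (Fin n)) (hLU : L ⊆ U) (k : Fin n) (hk : k ∈ U \ L)
    (hsink : ∀ j ∈ U \ L, ¬ Harms ξ L U k j)
    (ha : ∃ S : Finset (Fin n), insert k L ⊆ S ∧ S ⊆ U ∧
      ∀ i ∈ S, ξ i S = xiStar ξ (insert k L) U i) :
    ∃ S : Finset (Fin n), L ⊆ S ∧ S ⊆ U ∧ k ∈ S ∧
      ∀ j ∈ S \ L, ξ j S = xiStar ξ L U j := by
  obtain ⟨S, hS, hSU, hpay⟩ := ha
  obtain ⟨hkS, hLS⟩ := insert_subset_iff.mp hS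
  refine ⟨S, hLS, hSU, hkS, fun j hj => ?_⟩
  obtain ⟨hjS, hjL⟩ := mem_sdiff.mp hj
  rw [hpay j hjS]
  rcases eq_or_ne j k with rfl | hjk
  · exact xiStar_insert_self ξ L U j
  · have hjU := hSU hjS
    refine le_antisymm (not_lt.mp fun h => ?_)
      (xiStar_mono_left hξ (subset_insert k L) (hS.trans hSU) hjU)
    exact hsink j (mem_sdiff.mpr ⟨hjU, hjL⟩) ⟨hjk, h⟩
end
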